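/- Let n be a prime. For each j ∈ {1,2,3,4} there exists an invertible matrix B_j ∈ ℂ^{n²×n²} such that for every p ∈ {1,2,3,4} there is a nonzero complex scalar α with B_j⁻¹ A_p B_j = α · A₁^{d₁} A₂^{d₂} A₃^{d₃} A₄^{d₄}, where d_i ∈ {0,…,n−1} is the representative of the entry (D_j)_{ip} ∈ ℤ/nℤ; in particular each inner automorphism Ad_{B_j} of sl(n²,ℂ) lies in the normalizer of G and has coefficient matrix D_j. -/

import Mathlib

open Matrix Kronecker

noncomputable section

def ω (n : ℕ) : ℂ := Complex.exp (2 * Real.pi * Complex.I / n)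

def Pmat (n : ℕ) : Matrix (Fin n) (Fin n) ℂ := Matrix.diagonal fun i => ω n ^ (i : ℕ)

def Qmat (n : ℕ) : Matrix (Fin n) (Fin n) ℂ :=
  Matrix.of fun i j => if (j : ℕ) = ((i : ℕ) + 1) % n then 1 else 0

def Amat (n : ℕ) : Fin 4 → Matrix (Fin n × Fin n) (Fin n × Fin n) ℂ :=
  ![Pmat n ⊗ₖ 1, Qmat n ⊗ₖ 1, (1 : Matrix (Fin n) (Fin n) ℂ) ⊗ₖ Pmat n,
    (1 : Matrix (Fin n) (Fin n) ℂ) ⊗ₖ Qmat n]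

def J4 (n : ℕ) : Matrix (Fin 4) (Fin 4) (ZMod n) := !![0,1,0,0; -1,0,0,0; 0,0,0,1; 0,0,-1,0]
def Dmat (n : ℕ) : Fin 4 → Matrix (Fin 4) (Fin 4) (ZMod n) :=
  ![!![1,1,0,0; 0,1,0,0; 0,0,1,0; 0,0,0,1],
    !![0,1,0,0; -1,0,0,0; 0,0,1,0; 0,0,0,1],
    !![0,0,1,0; 0,0,0,1; 1,0,0,0; 0,1,0,0],
    !![1,0,0,0; 0,1,0,-1; 1,0,1,0; 0,0,0,1]]

open Fin.CommRing in
theorem Qmat_pow_apply (n : ℕ) [NeZero n] (k : ℕ) (i j : Fin n) :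
    (Qmat n ^ k) i j = if j = i + (k : Fin n) then 1 else 0 := by
  induction k generalizing i with
  | zero => simp [Matrix.one_apply, eq_comm]
  | succ k ih =>
    have hQ : ∀ x : Fin n, Qmat n i x = if x = i + 1 then 1 else 0 := fun x => by
      simp [Qmat, Fin.ext_iff, Fin.val_add]
    rw [pow_succ', Matrix.mul_apply]
    simp only [hQ, ite_mul, one_mul, zero_mul, Finset.sum_ite_eq', Finset.mem_univ, if_true, ih,
      Nat.cast_succ, add_assoc, add_comm (1 : Fin n)]

theorem omega_pow_self (n : ℕ) [NeZero n] : ω n ^ n = 1 :=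
  (Complex.isPrimitiveRoot_exp n (NeZero.ne n)).pow_eq_one

theorem omega_ne_zero (n : ℕ) : ω n ≠ 0 := Complex.exp_ne_zero _

theorem pow_fin_add {n : ℕ} [NeZero n] {x : ℂ} (hx : x ^ n = 1) (i j : Fin n) :
    x ^ ((i + j : Fin n) : ℕ) = x ^ (i : ℕ) * x ^ (j : ℕ) := by
  rw [Fin.val_add, ← pow_eq_pow_mod _ hx, pow_add]

theorem pow_fin_add_one {n : ℕ} [NeZero n] {x : ℂ} (hx : x ^ n = 1) (i : Fin n) :
    x ^ ((i + 1 : Fin n) : ℕ) = x ^ (i : ℕ) * x := by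
  rw [pow_fin_add hx, Fin.val_one', ← pow_eq_pow_mod 1 hx, pow_one]

open Fin.CommRing in
theorem Qmat_apply (n : ℕ) [NeZero n] (i j : Fin n) :
    Qmat n i j = if j = i + 1 then 1 else 0 := by
  simpa using Qmat_pow_apply n 1 i j

open Fin.CommRing in
theorem Qmat_pow_pred_apply (n : ℕ) [NeZero n] (i j : Fin n) :
    (Qmat n ^ (n - 1)) i j = if j + 1 = i then 1 else 0 := by
  have h : ((n - 1 : ℕ) : Fin n) = -1 := by
    rw [Nat.cast_sub (NeZero.one_le), Fin.natCast_self, Nat.cast_one, zero_sub]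
  simp only [Qmat_pow_apply, h, ← sub_eq_add_neg, eq_sub_iff_add_eq]

theorem Amat_monomial (n a b c d : ℕ) :
    Amat n 0 ^ a * Amat n 1 ^ b * Amat n 2 ^ c * Amat n 3 ^ d =
      (Pmat n ^ a * Qmat n ^ b) ⊗ₖ (Pmat n ^ c * Qmat n ^ d) := by
  have hl (M : Matrix (Fin n) (Fin n) ℂ) (k : ℕ) :
      (M ⊗ₖ (1 : Matrix (Fin n) (Fin n) ℂ)) ^ k = (M ^ k) ⊗ₖ 1 := by
    induction k with
    | zero => simp
    | succ k ih => rw [pow_succ, ih, ← mul_kronecker_mul, one_mul, pow_succ]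
  have hr (M : Matrix (Fin n) (Fin n) ℂ) (k : ℕ) :
      ((1 : Matrix (Fin n) (Fin n) ℂ) ⊗ₖ M) ^ k = 1 ⊗ₖ (M ^ k) := by
    induction k with
    | zero => simp
    | succ k ih => rw [pow_succ, ih, ← mul_kronecker_mul, one_mul, pow_succ]
  simp [Amat, hl, hr, ← mul_kronecker_mul]

theorem conj_eq_of_mul_eq {m : Type*} [Fintype m] [DecidableEq m] {B A X : Matrix m m ℂ}
    (hB : IsUnit B) {α : ℂ} (h : A * B = α • (B * X)) : B⁻¹ * A * B = α • X := by
  rw [mul_assoc, h, mul_smul_comm,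
    nonsing_inv_mul_cancel_left _ _ ((isUnit_iff_isUnit_det _).1 hB)]

/-- A diagonal matrix commuting with `Pmat n` that conjugates `Qmat n` to a multiple of
`Pmat n * Qmat n`. -/
theorem exists_diagonal_conj (n : ℕ) [NeZero n] :
    ∃ (B : Matrix (Fin n) (Fin n) ℂ) (α : ℂ), IsUnit B ∧ α ≠ 0 ∧ Pmat n * B = B * Pmat n ∧
      Qmat n * B = α • (B * (Pmat n * Qmat n)) := by
  obtain ⟨α, hα⟩ := IsAlgClosed.exists_pow_nat_eq ((ω n ^ n.choose 2)⁻¹) (NeZero.pos n)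
  have hω := omega_ne_zero n
  have hα0 : α ≠ 0 := by
    rintro rfl
    rw [zero_pow (NeZero.ne n)] at hα
    exact inv_ne_zero (pow_ne_zero _ hω) hα.symm
  have hf (i : Fin n) : α ^ ((i + 1 : Fin n) : ℕ) * ω n ^ ((i + 1 : Fin n) : ℕ).choose 2 =
      α * ω n ^ (i : ℕ) * (α ^ (i : ℕ) * ω n ^ (i : ℕ).choose 2) := by
    have hs : α * ω n ^ (i : ℕ) * (α ^ (i : ℕ) * ω n ^ (i : ℕ).choose 2) =
        α ^ ((i : ℕ) + 1) * ω n ^ ((i : ℕ) + 1).choose 2 := by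
      rw [Nat.choose_succ_succ' (i : ℕ) 1, Nat.choose_one_right]
      ring
    rw [hs, Fin.val_add, Fin.val_one', Nat.add_mod_mod]
    rcases (Nat.succ_le_of_lt i.isLt).lt_or_eq with h | h
    · rw [Nat.mod_eq_of_lt h]
    · rw [show (i : ℕ) + 1 = n from h, Nat.mod_self, hα, inv_mul_cancel₀ (pow_ne_zero _ hω)]
      simp
  refine ⟨diagonal fun i => α ^ (i : ℕ) * ω n ^ (i : ℕ).choose 2, α, ?_, hα0, ?_, ?_⟩
  · rw [isUnit_diagonal, Pi.isUnit_iff]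
    exact fun i => (mul_ne_zero (pow_ne_zero _ hα0) (pow_ne_zero _ hω)).isUnit
  · simp [Pmat, mul_comm]
  · ext i j
    rw [mul_diagonal, Matrix.smul_apply, diagonal_mul, Pmat, diagonal_mul, Qmat_apply]
    split_ifs with h
    · subst h
      rw [hf, smul_eq_mul]
      ring
    · simp

/-- The discrete Fourier matrix conjugates `Pmat n` to the inverse of `Qmat n`, and `Qmat n` to
`Pmat n`. -/
theorem exists_fourier_conj (n : ℕ) [NeZero n] :
    ∃ B : Matrix (Fin n) (Fin n) ℂ, IsUnit B ∧ Pmat n * B = B * Qmat n ^ (n - 1) ∧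
      Qmat n * B = B * Pmat n := by
  refine ⟨vandermonde fun i : Fin n => ω n ^ (i : ℕ), ?_, ?_, ?_⟩
  · rw [isUnit_iff_isUnit_det, isUnit_iff_ne_zero, det_vandermonde_ne_zero_iff]
    intro i j h
    exact Fin.ext ((Complex.isPrimitiveRoot_exp n (NeZero.ne n)).pow_inj i.isLt j.isLt h)
  · ext i j
    rw [Pmat, diagonal_mul, Matrix.mul_apply]
    simp only [Qmat_pow_pred_apply, vandermonde_apply, mul_ite, mul_one, mul_zero,
      Finset.sum_ite_eq, Finset.mem_univ, if_true]
    rw [pow_fin_add_one (by rw [pow_right_comm, omega_pow_self, one_pow]), mul_comm]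
  · ext i j
    rw [Pmat, mul_diagonal, Matrix.mul_apply]
    simp only [Qmat_apply, vandermonde_apply, ite_mul, one_mul, zero_mul,
      Finset.sum_ite_eq', Finset.mem_univ, if_true]
    rw [pow_fin_add_one (omega_pow_self n), mul_pow]

theorem isUnit_submatrix_one {m : Type*} [Fintype m] [DecidableEq m] (σ : Equiv.Perm m) :
    IsUnit ((1 : Matrix m m ℂ).submatrix σ id) := by
  have h := (isUnit_submatrix_equiv (A := (1 : Matrix m m ℂ)) σ (Equiv.refl m)).2 isUnit_one
  simpa using h

theorem conj_permutation_eq {m : Type*} [Fintype m] [DecidableEq m] (σ : Equiv.Perm m)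
    {A X : Matrix m m ℂ} (h : ∀ x y, A x y = X (σ x) (σ y)) :
    ((1 : Matrix m m ℂ).submatrix σ id)⁻¹ * A * (1 : Matrix m m ℂ).submatrix σ id =
      (1 : ℂ) • X := by
  refine conj_eq_of_mul_eq (isUnit_submatrix_one σ) ?_
  ext x y
  obtain ⟨y, rfl⟩ := σ.surjective y
  simp [Matrix.mul_apply, Matrix.one_apply, h]

/-- The permutation `(i, j) ↦ (i - j, j)`. -/
def shear (n : ℕ) [NeZero n] : Equiv.Perm (Fin n × Fin n) where
  toFun x := (x.1 - x.2, x.2)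
  invFun x := (x.1 + x.2, x.2)
  left_inv x := by simp
  right_inv x := by simp

/-- For `n` prime and each `j ∈ {1,2,3,4}` there is an invertible
`B_j ∈ ℂ^{n²×n²}` such that for every `p`, `B_j⁻¹ A_p B_j` is a nonzero scalar multiple of
`A₁^{d₁} A₂^{d₂} A₃^{d₃} A₄^{d₄}`, where `d_i ∈ {0,…,n−1}` represents `(D_j)_{ip} ∈ ℤ/nℤ`;
i.e. `Ad_{B_j}` lies in the normalizer of `G` with coefficient matrix `D_j`. -/
theorem statement17 (n : ℕ) (hn : n.Prime) :
    ∀ j : Fin 4, ∃ B : Matrix (Fin n × Fin n) (Fin n × Fin n) ℂ, IsUnit B ∧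
      ∀ p : Fin 4, ∃ α : ℂ, α ≠ 0 ∧
        B⁻¹ * Amat n p * B =
          α • (Amat n 0 ^ (Dmat n j 0 p).val * Amat n 1 ^ (Dmat n j 1 p).val *
               Amat n 2 ^ (Dmat n j 2 p).val * Amat n 3 ^ (Dmat n j 3 p).val) := by
  have : NeZero n := ⟨hn.ne_zero⟩
  have : Fact (1 < n) := ⟨hn.one_lt⟩
  have hneg : (-1 : ZMod n).val = n - 1 := by
    rw [ZMod.neg_val, if_neg one_ne_zero, ZMod.val_one]
  simp only [Amat_monomial]
  intro j
  fin_cases j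
  · obtain ⟨B, α, hB, hα, hP, hQ⟩ := exists_diagonal_conj n
    have hB' : IsUnit (B ⊗ₖ (1 : Matrix (Fin n) (Fin n) ℂ)) := hB.kronecker isUnit_one
    refine ⟨B ⊗ₖ 1, hB', fun p => ?_⟩
    fin_cases p
    · refine ⟨1, one_ne_zero, conj_eq_of_mul_eq hB' ?_⟩
      simp [Amat, Dmat, ZMod.val_one, ← mul_kronecker_mul, hP]
    · refine ⟨α, hα, conj_eq_of_mul_eq hB' ?_⟩
      simp [Amat, Dmat, ZMod.val_one, ← mul_kronecker_mul, hQ, smul_kronecker]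
    · refine ⟨1, one_ne_zero, conj_eq_of_mul_eq hB' ?_⟩
      simp [Amat, Dmat, ZMod.val_one, ← mul_kronecker_mul]
    · refine ⟨1, one_ne_zero, conj_eq_of_mul_eq hB' ?_⟩
      simp [Amat, Dmat, ZMod.val_one, ← mul_kronecker_mul]
  · obtain ⟨B, hB, hP, hQ⟩ := exists_fourier_conj n
    have hB' : IsUnit (B ⊗ₖ (1 : Matrix (Fin n) (Fin n) ℂ)) := hB.kronecker isUnit_one
    refine ⟨B ⊗ₖ 1, hB', fun p => ⟨1, one_ne_zero, conj_eq_of_mul_eq hB' ?_⟩⟩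
    fin_cases p <;> simp [Amat, Dmat, ZMod.val_one, ← mul_kronecker_mul, hP, hQ, hneg]
  · refine ⟨_, isUnit_submatrix_one (Equiv.prodComm (Fin n) (Fin n)),
      fun p => ⟨1, one_ne_zero, conj_permutation_eq _ fun ⟨a, b⟩ ⟨c, d⟩ => ?_⟩⟩
    fin_cases p <;> simp [Amat, Dmat, ZMod.val_one, kroneckerMap_apply, mul_comm]
  · refine ⟨_, isUnit_submatrix_one (shear n),
      fun p => ⟨1, one_ne_zero, conj_permutation_eq _ fun ⟨a, b⟩ ⟨c, d⟩ => ?_⟩⟩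
    fin_cases p
    · have h := pow_fin_add (omega_pow_self n) (a - b) b
      rw [sub_add_cancel] at h
      by_cases hbd : b = d <;> by_cases hac : a = c <;>
        simp [Amat, Dmat, ZMod.val_one, kroneckerMap_apply, shear, Pmat, diagonal_apply,
          hbd, hac]
      rw [← hac, ← hbd, h]
    · by_cases hbd : b = d <;>
        simp [Amat, Dmat, ZMod.val_one, kroneckerMap_apply, shear, Qmat_apply, hbd]
      simp only [sub_add_eq_add_sub, sub_left_inj]
    · by_cases hbd : b = d <;>
        simp [Amat, Dmat, ZMod.val_one, kroneckerMap_apply, shear, Pmat,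
          Matrix.one_apply, hbd]
    · simp [Amat, Dmat, ZMod.val_one, kroneckerMap_apply, shear, Qmat_apply, hneg,
          Qmat_pow_pred_apply, Matrix.one_apply]
      split_ifs with h₁ h₂ h₃ h₃ <;> first | rfl | (exfalso; subst h₁)
      · exact h₃ (by rw [h₂]; abel)
      · exact h₂ (by rw [← sub_left_inj (a := b), ← h₃]; abel)
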